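/- arXiv:1902.07163 — 2 statements merged into one kernel-verified Lean document; each statement's English description precedes it below -/
import Mathlib

section
/- For any 2×2 real matrix T, the matrix C(T, 0) (i.e. C(T,N) with N the zero matrix) is positive semidefinite if and only if det T = 1; equivalently, a one-mode Gaussian channel with vanishing noise matrix N = 0 is completely positive if and only if T is symplectic. -/
open Matrix Complex
open scoped ComplexOrder

/-- The one-mode symplectic form `Ω = !![0, 1; -1, 0]`. -/
noncomputable def Omega : Matrix (Fin 2) (Fin 2) ℝ := !![0, 1; -1, 0]

/-- The complete-positivity matrix `C(T,N) = N + i·Ω − i·T·Ω·Tᵀ`, real matrices viewed as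
complex via the canonical embedding. -/
noncomputable def Cmat (T N : Matrix (Fin 2) (Fin 2) ℝ) : Matrix (Fin 2) (Fin 2) ℂ :=
  N.map (fun x => (x : ℂ)) + Complex.I • (Omega.map (fun x => (x : ℂ)))
    - Complex.I • ((T * Omega * Tᵀ).map (fun x => (x : ℂ)))


theorem mul_Omega_mul_transpose (T : Matrix (Fin 2) (Fin 2) ℝ) :
    T * Omega * Tᵀ = T.det • Omega := by
  ext i j
  fin_cases i <;> fin_cases j <;>
    simp [Omega, Matrix.mul_apply, Fin.sum_univ_two, Matrix.det_fin_two] <;> ring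

theorem smul_Omega_eq_Omega_iff (d : ℝ) : d • Omega = Omega ↔ d = 1 := by
  refine ⟨fun h => ?_, fun h => by rw [h, one_smul]⟩
  simpa [Omega] using congrFun (congrFun h 0) 1

theorem det_Cmat_zero (T : Matrix (Fin 2) (Fin 2) ℝ) :
    (Cmat T 0).det = ((-(1 - T.det) ^ 2 : ℝ) : ℂ) := by
  rw [Cmat, mul_Omega_mul_transpose, Matrix.det_fin_two]
  simp [Omega]
  linear_combination -(1 - (T.det : ℂ)) ^ 2 * Complex.I_sq

theorem Cmat_zero_posSemidef_iff (T : Matrix (Fin 2) (Fin 2) ℝ) :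
    (Cmat T 0).PosSemidef ↔ T.det = 1 := by
  constructor
  · intro h
    have hdet := h.det_nonneg
    rw [det_Cmat_zero, Complex.zero_le_real] at hdet
    nlinarith [sq_nonneg (1 - T.det)]
  · intro h
    have hC : Cmat T 0 = 0 := by
      rw [Cmat, mul_Omega_mul_transpose, h, one_smul]
      ext i j
      simp
    rw [hC]
    exact Matrix.PosSemidef.zero

/-- `C(T,0)` is positive semidefinite iff `det T = 1`, equivalently iff `T` is symplectic:
a Gaussian channel with vanishing noise matrix is completely positive iff `T` is symplectic. -/
theorem stmt_3 (T : Matrix (Fin 2) (Fin 2) ℝ) :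
    ((Cmat T 0).PosSemidef ↔ T.det = 1) ∧
      ((Cmat T 0).PosSemidef ↔ T * Omega * Tᵀ = Omega) := by
  refine ⟨Cmat_zero_posSemidef_iff T, ?_⟩
  rw [mul_Omega_mul_transpose, smul_Omega_eq_Omega_iff]
  exact Cmat_zero_posSemidef_iff T
end

section
/- Let e1 > 0, β > 0, and let α, e2, φ, P11, P12, P22 be arbitrary real numbers. Set T = !![e2/(2e1), 0; φ, -α/β] and N = !![-2P22, 2P12; 2P12, -2P11]. Then C(T,N) is positive semidefinite if and only if −(P11 + P22) ≥ √(α²e2² + 4αβe2e1 + 4β²e1²(4P12² + (P11 − P22)² + 1)) / (2βe1). In particular, this complete-positivity condition does not depend on the entry φ. -/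
open Matrix Complex
open scoped ComplexOrder

/-- A complex Hermitian `2 × 2` matrix, written in real coordinates, is positive semidefinite
iff its trace and determinant are nonnegative. -/
theorem posSemidef_fin_two_iff (a b d k : ℝ) :
    (!![(a : ℂ), b + I * k; b - I * k, d]).PosSemidef ↔ 0 ≤ a + d ∧ b ^ 2 + k ^ 2 ≤ a * d := by
  constructor
  · intro h
    have htr := h.trace_nonneg
    have hdet := h.det_nonneg
    rw [Matrix.trace_fin_two_of, Complex.le_def] at htr
    rw [Matrix.det_fin_two_of, Complex.le_def] at hdet
    have h1 := htr.1
    have h2 := hdet.1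
    simp at h1 h2
    exact ⟨h1, by linarith⟩
  · rintro ⟨htr, hdet⟩
    refine Matrix.PosSemidef.of_dotProduct_mulVec_nonneg ?_ fun v => ?_
    · ext i j
      fin_cases i <;> fin_cases j <;> simp [Complex.ext_iff]
    have ha : 0 ≤ a := by nlinarith [sq_nonneg b, sq_nonneg k, sq_nonneg d]
    have hd : 0 ≤ d := by nlinarith [sq_nonneg b, sq_nonneg k, sq_nonneg a]
    rw [Complex.le_def]
    simp only [dotProduct, Matrix.mulVec, Fin.sum_univ_two]
    obtain ⟨x, hx⟩ : ∃ x, v 0 = x := ⟨_, rfl⟩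
    obtain ⟨y, hy⟩ : ∃ y, v 1 = y := ⟨_, rfl⟩
    simp [hx, hy]
    constructor
    · obtain ⟨p, q⟩ := x
      obtain ⟨r, s⟩ := y
      simp only
      rcases ha.eq_or_lt with rfl | ha
      · have hb : b = 0 := by nlinarith [sq_nonneg b, sq_nonneg k]
        have hk : k = 0 := by nlinarith [sq_nonneg b, sq_nonneg k]
        subst hb hk
        nlinarith [mul_nonneg hd (sq_nonneg r), mul_nonneg hd (sq_nonneg s)]
      · refine nonneg_of_mul_nonneg_right ?_ ha
        nlinarith [sq_nonneg (a * p + b * r - k * s), sq_nonneg (a * q + b * s + k * r),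
          mul_nonneg (sub_nonneg.2 hdet) (add_nonneg (sq_nonneg r) (sq_nonneg s))]
    · ring

/-- For `2 × 2` matrices, `T Ω Tᵀ = (det T) Ω`, so `T` enters `C(T,N)` only through `det T`. -/
theorem Cmat_eq (T : Matrix (Fin 2) (Fin 2) ℝ) (a b d : ℝ) :
    Cmat T !![a, b; b, d] =
      !![(a : ℂ), b + I * (1 - T.det : ℝ); b - I * (1 - T.det : ℝ), d] := by
  ext i j
  fin_cases i <;> fin_cases j <;>
    simp [Cmat, Omega, Matrix.mul_apply, Fin.sum_univ_two, Matrix.det_fin_two] <;> ring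

/-- For `e1 > 0`, `β > 0`, with `T = !![e2/(2e1), 0; φ, -α/β]` and
`N = !![-2P22, 2P12; 2P12, -2P11]`, the matrix `C(T,N)` is positive semidefinite iff
`−(P11 + P22) ≥ √(α²e2² + 4αβe2e1 + 4β²e1²(4P12² + (P11 − P22)² + 1)) / (2βe1)`.
In particular the condition does not depend on `φ`. -/
theorem stmt_12 (e1 β α e2 φ P11 P12 P22 : ℝ) (he1 : 0 < e1) (hβ : 0 < β) :
    (Cmat (!![e2 / (2 * e1), 0; φ, -α / β])
          (!![-2 * P22, 2 * P12; 2 * P12, -2 * P11])).PosSemidef ↔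
      Real.sqrt (α ^ 2 * e2 ^ 2 + 4 * α * β * e2 * e1 +
          4 * β ^ 2 * e1 ^ 2 * (4 * P12 ^ 2 + (P11 - P22) ^ 2 + 1)) / (2 * β * e1)
        ≤ -(P11 + P22) := by
  rw [Cmat_eq, posSemidef_fin_two_iff, Matrix.det_fin_two_of, div_le_iff₀ (by positivity),
    Real.sqrt_le_iff]
  have hpos : 0 < 2 * β * e1 := by positivity
  have hk : 1 - (e2 / (2 * e1) * (-α / β) - 0 * φ) = (2 * β * e1 + α * e2) / (2 * β * e1) := by
    field_simp
    ring
  rw [hk, div_pow]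
  refine and_congr ?_ ?_
  · rw [mul_nonneg_iff_of_pos_right hpos]
    constructor <;> intro h <;> linarith
  · rw [← le_sub_iff_add_le', div_le_iff₀ (by positivity)]
    constructor <;> intro h <;> linarith
end
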